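/- In the setup below, if x ∈ {u3, u4}, then x and y are adjacent in G; that is, the edge xy is e or f. -/

import Mathlib

open SimpleGraph

variable {V : Type*}

/-- The list of internal vertices of a walk (its support minus the two ends). -/
def interiorL {G : SimpleGraph V} {a b : V} (p : G.Walk a b) : List V :=
  p.support.tail.dropLast

/-- `p` is an induced path of `G`: a path such that the only edges of `G` between
vertices of `p` are the edges of `p`. -/
def IsInducedPath (G : SimpleGraph V) {a b : V} (p : G.Walk a b) : Prop :=
  p.IsPath ∧ ∀ x ∈ p.support, ∀ y ∈ p.support, G.Adj x y → s(x, y) ∈ p.edges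

/-- A hole of `G`: an induced (chordless) cycle of length at least 4. -/
def IsHole (G : SimpleGraph V) {v : V} (c : G.Walk v v) : Prop :=
  c.IsCycle ∧ 4 ≤ c.length ∧
    ∀ x ∈ c.support, ∀ y ∈ c.support, G.Adj x y → s(x, y) ∈ c.edges

/-- An odd hole of `G`: a hole of odd length. -/
def IsOddHole (G : SimpleGraph V) {v : V} (c : G.Walk v v) : Prop :=
  IsHole G c ∧ Odd c.length

/-- `G ∈ 𝒢ℓ`: `G` has girth `2ℓ+1` and every odd hole of `G` has length exactly `2ℓ+1`
(equivalently, no odd hole of length at least `2ℓ+3`). -/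
def InGFamily (ℓ : ℕ) (G : SimpleGraph V) : Prop :=
  G.egirth = (2 * ℓ + 1 : ℕ) ∧
    ∀ (v : V) (c : G.Walk v v), IsOddHole G c → c.length = 2 * ℓ + 1

/-- `G` is `k`-vertex-critical: `χ(G) = k` and `χ(G − v) < k` for every vertex `v`. -/
def VertexCritical (k : ℕ) (G : SimpleGraph V) : Prop :=
  G.chromaticNumber = (k : ℕ∞) ∧
    ∀ v : V, (G.induce ({v}ᶜ : Set V)).chromaticNumber < (k : ℕ∞)

/-- An odd `K₄`-subdivision in `G`: four distinct branch vertices `u1, u2, u3, u4`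
joined by six internally disjoint paths (the arrises), such that the four face cycles
are all odd holes of `G`. -/
structure OddK4 (G : SimpleGraph V) where
  u1 : V
  u2 : V
  u3 : V
  u4 : V
  /-- the arris joining `u1` and `u2` -/
  P1 : G.Walk u1 u2
  /-- the arris joining `u3` and `u4` -/
  P2 : G.Walk u3 u4
  /-- the arris joining `u2` and `u3` -/
  Q1 : G.Walk u2 u3
  /-- the arris joining `u1` and `u4` -/
  Q2 : G.Walk u1 u4
  /-- the arris joining `u1` and `u3` -/
  L1 : G.Walk u1 u3
  /-- the arris joining `u2` and `u4` -/
  L2 : G.Walk u2 u4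
  hP1 : P1.IsPath
  hP2 : P2.IsPath
  hQ1 : Q1.IsPath
  hQ2 : Q2.IsPath
  hL1 : L1.IsPath
  hL2 : L2.IsPath
  /-- the four branch vertices are pairwise distinct -/
  hnodup : List.Nodup [u1, u2, u3, u4]
  /-- the interiors of the six arrises are pairwise disjoint -/
  hdisj : List.Pairwise List.Disjoint
    [interiorL P1, interiorL P2, interiorL Q1, interiorL Q2, interiorL L1, interiorL L2]
  /-- no branch vertex lies in the interior of an arris -/
  hbranch : ∀ x ∈ interiorL P1 ++ interiorL P2 ++ interiorL Q1 ++ interiorL Q2 ++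
      interiorL L1 ++ interiorL L2, x ∉ [u1, u2, u3, u4]
  /-- the face `u1u2u3` is an odd hole of `G` -/
  face1 : IsOddHole G (P1.append (Q1.append L1.reverse))
  /-- the face `u1u2u4` is an odd hole of `G` -/
  face2 : IsOddHole G (P1.append (L2.append Q2.reverse))
  /-- the face `u1u3u4` is an odd hole of `G` -/
  face3 : IsOddHole G (L1.append (P2.append Q2.reverse))
  /-- the face `u2u3u4` is an odd hole of `G` -/
  face4 : IsOddHole G (Q1.append (P2.append L2.reverse))

/-- The subgraph of `G` formed by an odd `K₄`-subdivision. -/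
def OddK4.toSubgraph {G : SimpleGraph V} (K : OddK4 G) : G.Subgraph :=
  K.P1.toSubgraph ⊔ K.P2.toSubgraph ⊔ K.Q1.toSubgraph ⊔ K.Q2.toSubgraph ⊔
    K.L1.toSubgraph ⊔ K.L2.toSubgraph

/-- The vertex set of an odd `K₄`-subdivision. -/
def OddK4.verts {G : SimpleGraph V} (K : OddK4 G) : Set V :=
  K.toSubgraph.verts

/-- `P1, P2` form a pair of longest arrises of the odd `K₄`-subdivision `K`. -/
def OddK4.longestPair {G : SimpleGraph V} (K : OddK4 G) : Prop :=
  K.Q1.length ≤ K.P1.length ∧ K.Q2.length ≤ K.P1.length ∧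
    K.L1.length ≤ K.P1.length ∧ K.L2.length ≤ K.P1.length ∧
    K.Q1.length ≤ K.P2.length ∧ K.Q2.length ≤ K.P2.length ∧
    K.L1.length ≤ K.P2.length ∧ K.L2.length ≤ K.P2.length

/-- The difference `d(H) = |P1| − min(|Q1|, |L1|)` of an odd `K₄`-subdivision
(labelled so that `P1, P2` is a pair of longest arrises). -/
def OddK4.diff {G : SimpleGraph V} (K : OddK4 G) : ℕ :=
  K.P1.length - min K.Q1.length K.L1.length

namespace SimpleGraph.Walk

variable {G : SimpleGraph V} {a b c d : V}

lemma mem_support_of_mem_interiorL {p : G.Walk a b} {w : V} (h : w ∈ interiorL p) :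
    w ∈ p.support :=
  List.mem_of_mem_tail (List.mem_of_mem_dropLast h)

lemma eq_or_mem_interiorL {p : G.Walk a b} {w : V} (h : w ∈ p.support) :
    w = a ∨ w = b ∨ w ∈ interiorL p := by
  refine (p.mem_support_iff.mp h).imp_right fun h1 ↦ ?_
  have hne : p.support.tail ≠ [] := List.ne_nil_of_mem h1
  have h2 : p.support.tail.getLast hne = b := by
    rw [List.getLast_tail, getLast_support]
  rw [← List.dropLast_append_getLast hne, h2, List.mem_append, List.mem_singleton] at h1
  exact h1.symm

lemma interiorL_reverse (p : G.Walk a b) : interiorL p.reverse = (interiorL p).reverse := by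
  simp [interiorL, List.tail_reverse, List.dropLast_reverse, List.tail_dropLast]

lemma IsPath.append_of_inter {p : G.Walk a b} {q : G.Walk b c} (hp : p.IsPath) (hq : q.IsPath)
    (h : ∀ w ∈ p.support, w ∈ q.support → w = b) : (p.append q).IsPath := by
  rw [isPath_def, support_append, List.nodup_append']
  refine ⟨hp.support_nodup, hq.support_nodup.tail, fun w hw hw' ↦ ?_⟩
  obtain rfl := h w hw (List.mem_of_mem_tail hw')
  have := hq.support_nodup
  rw [← cons_tail_support] at this
  exact (List.nodup_cons.mp this).1 hw'

lemma two_le_length_of_not_adj {p : G.Walk a b} (hne : a ≠ b) (h : ¬ G.Adj a b) :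
    2 ≤ p.length := by
  match p with
  | nil => exact absurd rfl hne
  | cons h' nil => exact absurd h' h
  | cons _ (cons _ _) => simp

lemma ends_of_mem_edges {p : G.Walk a b} (h : s(c, d) ∈ p.edges) :
    c ≠ d ∧ c ∈ p.support ∧ d ∈ p.support ∧ s(c, d) ∈ p.edges :=
  ⟨(p.adj_of_mem_edges h).ne, p.fst_mem_support_of_mem_edges h,
    p.snd_mem_support_of_mem_edges h, h⟩

lemma not_mem_edges_of_length_ne_one {p : G.Walk a b} (hp : p.IsPath) (hl : p.length ≠ 1) :
    s(a, b) ∉ p.edges ∧ s(b, a) ∉ p.edges := by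
  rw [Sym2.eq_swap (a := b), and_self]
  exact mt hp.length_eq_one_of_mem_edges hl

lemma isHole_append {p : G.Walk a b} {q : G.Walk b a} (hp : IsInducedPath G p)
    (hq : IsInducedPath G q) (hne : a ≠ b) (hab : ¬ G.Adj a b)
    (hinter : ∀ w ∈ p.support, w ∈ q.support → w = a ∨ w = b)
    (hcross : ∀ w ∈ p.support, ∀ z ∈ q.support, G.Adj w z →
      s(w, z) ∈ p.edges ∨ s(w, z) ∈ q.edges) :
    IsHole G (p.append q) := by
  have hlp := two_le_length_of_not_adj (p := p) hne hab
  have hlq := two_le_length_of_not_adj (p := q) hne.symm (fun h ↦ hab h.symm)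
  refine ⟨hp.1.isCycle_append hq.1 (fun w hw hw' ↦ ?_) (.inl (by omega)), ?_, ?_⟩
  · have h1 := hp.1.support_nodup
    have h2 := hq.1.support_nodup
    rw [← cons_tail_support] at h1 h2
    have h1 := (List.nodup_cons.mp h1).1
    have h2 := (List.nodup_cons.mp h2).1
    rcases hinter w (List.mem_of_mem_tail hw) (List.mem_of_mem_tail hw') with rfl | rfl <;>
      contradiction
  · rw [length_append]
    omega
  · intro w hw z hz h
    rw [mem_support_append_iff] at hw hz
    rw [edges_append, List.mem_append]
    have := hcross z
    have := hcross w
    have := hp.2 w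
    have := hq.2 w
    grind [Sym2.eq_swap, SimpleGraph.adj_comm]

lemma egirth_le_length_add_one (p : G.Walk b a) (h : G.Adj a b) (hp : s(a, b) ∉ p.edges) :
    G.egirth ≤ (p.length + 1 : ℕ) := by
  classical
  have hc : (cons h p.bypass).IsCycle :=
    (cons_isCycle_iff _ h).2 ⟨p.bypass_isPath, fun h' ↦ hp (p.edges_bypass_subset_edges h')⟩
  refine (egirth_le_length hc).trans ?_
  have := p.length_bypass_le_length
  simpa using mod_cast this

/-- A chord joining two opposite arrises of a `K₄`-subdivision splits it into four short cycles. -/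
lemma four_mul_le_of_adj_of_notMem_edges {n : ℕ} (hn : (n : ℕ∞) ≤ G.egirth) (p : G.Walk a b)
    (q : G.Walk c d) (ac : G.Walk a c) (ad : G.Walk a d) (bc : G.Walk b c) (bd : G.Walk b d)
    {s t : V} (hs : s ∈ p.support) (ht : t ∈ q.support) (hst : G.Adj s t)
    (hp : s(s, t) ∉ p.edges) (hq : s(s, t) ∉ q.edges) (hac : s(s, t) ∉ ac.edges)
    (had : s(s, t) ∉ ad.edges) (hbc : s(s, t) ∉ bc.edges) (hbd : s(s, t) ∉ bd.edges) :
    4 * n ≤ 2 * (p.length + q.length) + ac.length + ad.length + bc.length + bd.length + 4 := by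
  obtain ⟨p₁, p₂, rfl⟩ := mem_support_iff_exists_append.mp hs
  obtain ⟨q₁, q₂, rfl⟩ := mem_support_iff_exists_append.mp ht
  simp only [edges_append, List.mem_append, not_or] at hp hq
  have key (w : G.Walk s t) (hw : s(s, t) ∉ w.edges) : n ≤ w.length + 1 := by
    have := hn.trans (egirth_le_length_add_one w.reverse hst (by simpa using hw))
    rw [length_reverse] at this
    exact mod_cast this
  have h1 := key (p₁.reverse.append (ac.append q₁)) (by simp [*])
  have h2 := key (p₁.reverse.append (ad.append q₂.reverse)) (by simp [*])
  have h3 := key (p₂.append (bc.append q₁)) (by simp [*])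
  have h4 := key (p₂.append (bd.append q₂.reverse)) (by simp [*])
  simp only [length_append, length_reverse] at *
  omega

lemma le_length_add_length_of_disjoint_edges {n : ℕ} (hn : (n : ℕ∞) ≤ G.egirth) {p : G.Walk a b}
    (hp : p.IsPath) (hne : a ≠ b) (q : G.Walk b a) (h : ∀ e ∈ p.edges, e ∉ q.edges) :
    n ≤ p.length + q.length := by
  cases p with
  | nil => exact absurd rfl hne
  | @cons _ v _ hv p =>
    have hp' := cons_isPath_iff hv p |>.mp hp
    have := hn.trans (egirth_le_length_add_one (p.append q) hv (by
      rw [edges_append, List.mem_append, not_or]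
      exact ⟨fun h' ↦ hp'.2 (p.fst_mem_support_of_mem_edges h'), h _ (by simp)⟩))
    have : n ≤ (p.append q).length + 1 := mod_cast this
    simp only [length_append, length_cons] at *
    omega

end SimpleGraph.Walk

open SimpleGraph.Walk

lemma IsOddHole.reverse {G : SimpleGraph V} {v : V} {c : G.Walk v v} (h : IsOddHole G c) :
    IsOddHole G c.reverse := by
  obtain ⟨⟨h1, h2, h3⟩, h4⟩ := h
  exact ⟨⟨h1.reverse, by simpa using h2, by simpa using h3⟩, by simpa using h4⟩

namespace OddK4

variable {G : SimpleGraph V} (K : OddK4 G)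

lemma mem_verts {w : V} : w ∈ K.verts ↔ w ∈ K.P1.support ∨ w ∈ K.P2.support ∨ w ∈ K.Q1.support ∨
    w ∈ K.Q2.support ∨ w ∈ K.L1.support ∨ w ∈ K.L2.support := by
  simp only [verts, toSubgraph, Subgraph.verts_sup, Set.mem_union, mem_verts_toSubgraph, or_assoc]

lemma adj_toSubgraph (s t : V) : K.toSubgraph.Adj s t ↔ s(s, t) ∈ K.P1.edges ∨
    s(s, t) ∈ K.P2.edges ∨ s(s, t) ∈ K.Q1.edges ∨ s(s, t) ∈ K.Q2.edges ∨ s(s, t) ∈ K.L1.edges ∨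
    s(s, t) ∈ K.L2.edges := by
  simp only [toSubgraph, Subgraph.sup_adj, adj_toSubgraph_iff_mem_edges, or_assoc]

/-- Opposite arrises are disjoint, and two other arrises only share a branch vertex. -/
lemma inter_support (w : V) :
    (w ∈ K.P1.support → w ∉ K.P2.support) ∧ (w ∈ K.Q1.support → w ∉ K.Q2.support) ∧
    (w ∈ K.L1.support → w ∉ K.L2.support) ∧
    (w ∈ K.P1.support → w ∈ K.Q1.support → w = K.u2) ∧
    (w ∈ K.P1.support → w ∈ K.Q2.support → w = K.u1) ∧
    (w ∈ K.P1.support → w ∈ K.L1.support → w = K.u1) ∧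
    (w ∈ K.P1.support → w ∈ K.L2.support → w = K.u2) ∧
    (w ∈ K.P2.support → w ∈ K.Q1.support → w = K.u3) ∧
    (w ∈ K.P2.support → w ∈ K.Q2.support → w = K.u4) ∧
    (w ∈ K.P2.support → w ∈ K.L1.support → w = K.u3) ∧
    (w ∈ K.P2.support → w ∈ K.L2.support → w = K.u4) ∧
    (w ∈ K.Q1.support → w ∈ K.L1.support → w = K.u3) ∧
    (w ∈ K.Q1.support → w ∈ K.L2.support → w = K.u2) ∧
    (w ∈ K.Q2.support → w ∈ K.L1.support → w = K.u1) ∧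
    (w ∈ K.Q2.support → w ∈ K.L2.support → w = K.u4) := by
  have hn := K.hnodup
  have hd := K.hdisj
  have hb := K.hbranch w
  simp only [List.nodup_cons, List.mem_cons, List.not_mem_nil, or_false, not_or,
    List.mem_append, List.pairwise_cons, List.Disjoint, forall_eq, or_imp] at hn hd hb
  have h1 := eq_or_mem_interiorL (p := K.P1) (w := w)
  have h2 := eq_or_mem_interiorL (p := K.P2) (w := w)
  have h3 := eq_or_mem_interiorL (p := K.Q1) (w := w)
  have h4 := eq_or_mem_interiorL (p := K.Q2) (w := w)
  have h5 := eq_or_mem_interiorL (p := K.L1) (w := w)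
  have h6 := eq_or_mem_interiorL (p := K.L2) (w := w)
  refine ⟨?_, ?_, ?_, ?_, ?_, ?_, ?_, ?_, ?_, ?_, ?_, ?_, ?_, ?_, ?_⟩ <;> grind

/-- The `K₄`-subdivision with the labels of `u3` and `u4` exchanged. -/
def swap : OddK4 G where
  u1 := K.u1
  u2 := K.u2
  u3 := K.u4
  u4 := K.u3
  P1 := K.P1
  P2 := K.P2.reverse
  Q1 := K.L2
  Q2 := K.L1
  L1 := K.Q2
  L2 := K.Q1
  hP1 := K.hP1
  hP2 := K.hP2.reverse
  hQ1 := K.hL2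
  hQ2 := K.hL1
  hL1 := K.hQ2
  hL2 := K.hQ1
  hnodup := by
    have := K.hnodup
    grind
  hdisj := by
    have hd := K.hdisj
    simp only [List.mem_cons, List.not_mem_nil, or_false, List.pairwise_cons, List.Disjoint,
      forall_eq_or_imp, forall_eq, interiorL_reverse, List.mem_reverse] at hd ⊢
    grind
  hbranch := by
    have hb := K.hbranch
    simp only [List.mem_append, interiorL_reverse, List.mem_reverse, List.mem_cons] at hb ⊢
    grind
  face1 := K.face2
  face2 := K.face1
  face3 := by simpa [reverse_append, append_assoc] using K.face3.reverse
  face4 := by simpa [reverse_append, append_assoc] using K.face4.reverse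

lemma longestPair.swap {K : OddK4 G} (h : K.longestPair) : K.swap.longestPair := by
  simp only [longestPair, OddK4.swap, length_reverse] at h ⊢
  tauto

lemma verts_swap : K.swap.verts = K.verts := by
  ext w
  simp only [mem_verts, OddK4.swap, support_reverse, List.mem_reverse]
  tauto

variable {K} {ℓ : ℕ}

lemma length_eq (hG : InGFamily ℓ G) : K.P2.length = K.P1.length ∧ K.Q2.length = K.Q1.length ∧
    K.L2.length = K.L1.length ∧ K.P1.length + K.Q1.length + K.L1.length = 2 * ℓ + 1 := by
  have h1 := hG.2 _ _ K.face1
  have h2 := hG.2 _ _ K.face2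
  have h3 := hG.2 _ _ K.face3
  have h4 := hG.2 _ _ K.face4
  simp only [length_append, length_reverse] at h1 h2 h3 h4
  omega

lemma length_P1_le (hG : InGFamily ℓ G) : K.P1.length ≤ ℓ := by
  have hn := K.hnodup
  have h := le_length_add_length_of_disjoint_edges hG.1.ge K.hL1 (by grind)
    (K.Q1.reverse.append (K.L2.append K.Q2.reverse)) (by
      rintro ⟨a, b⟩ he he'
      have := K.L1.fst_mem_support_of_mem_edges he
      have := K.L1.snd_mem_support_of_mem_edges he
      have hab := (K.L1.adj_of_mem_edges he).ne
      simp only [edges_append, edges_reverse, List.mem_append, List.mem_reverse] at he'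
      have ha := K.inter_support a
      have hb := K.inter_support b
      rcases he' with he' | he' | he' <;>
        have := fst_mem_support_of_mem_edges _ he' <;>
        have := snd_mem_support_of_mem_edges _ he' <;>
        grind)
  obtain ⟨h1, h2, h3, h4⟩ := K.length_eq hG
  simp only [length_append, length_reverse] at h
  omega

/-- An odd `K₄`-subdivision in a graph of `𝒢ℓ` is an induced subgraph. -/
lemma isInduced (hG : InGFamily ℓ G) (hℓ : 2 ≤ ℓ) (hlong : K.longestPair) :
    K.toSubgraph.IsInduced := by
  intro a ha b hb hab
  change a ∈ K.verts at ha
  change b ∈ K.verts at hb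
  have f1 := K.face1.1.2.2
  have f2 := K.face2.1.2.2
  have f3 := K.face3.1.2.2
  have f4 := K.face4.1.2.2
  simp only [mem_support_append_iff, edges_append, support_reverse, edges_reverse, List.mem_append,
    List.mem_reverse] at f1 f2 f3 f4
  obtain ⟨h1, h2, h3, h4⟩ := K.length_eq hG
  have h5 := K.length_P1_le hG
  have h6 := hlong.1
  have h7 := hlong.2.2.1
  have hP {s t : V} (hs : s ∈ K.P1.support) (ht : t ∈ K.P2.support) (hst : G.Adj s t) :
      K.toSubgraph.Adj s t := by
    by_contra hne
    simp only [adj_toSubgraph, not_or] at hne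
    obtain ⟨e1, e2, e3, e4, e5, e6⟩ := hne
    have := four_mul_le_of_adj_of_notMem_edges hG.1.ge K.P1 K.P2 K.L1 K.Q2 K.Q1 K.L2 hs ht hst
      e1 e2 e5 e4 e3 e6
    omega
  have hQ {s t : V} (hs : s ∈ K.Q1.support) (ht : t ∈ K.Q2.support) (hst : G.Adj s t) :
      K.toSubgraph.Adj s t := by
    by_contra hne
    simp only [adj_toSubgraph, not_or] at hne
    obtain ⟨e1, e2, e3, e4, e5, e6⟩ := hne
    have := four_mul_le_of_adj_of_notMem_edges hG.1.ge K.Q1 K.Q2 K.P1.reverse K.L2 K.L1.reverse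
      K.P2 hs ht hst e3 e4 (by simpa) e6 (by simpa) e2
    simp only [length_reverse] at this
    omega
  have hL {s t : V} (hs : s ∈ K.L1.support) (ht : t ∈ K.L2.support) (hst : G.Adj s t) :
      K.toSubgraph.Adj s t := by
    by_contra hne
    simp only [adj_toSubgraph, not_or] at hne
    obtain ⟨e1, e2, e3, e4, e5, e6⟩ := hne
    have := four_mul_le_of_adj_of_notMem_edges hG.1.ge K.L1 K.L2 K.P1 K.Q2 K.Q1.reverse
      K.P2 hs ht hst e5 e6 e1 e4 (by simpa) e2
    simp only [length_reverse] at this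
    omega
  have f1 := f1 a
  have f2 := f2 a
  have f3 := f3 a
  have f4 := f4 a
  have hab' := K.adj_toSubgraph a b
  have hcomm := K.toSubgraph.adj_comm a b
  have := hab.symm
  rw [mem_verts] at ha hb
  rcases ha with ha | ha | ha | ha | ha | ha <;> rcases hb with hb | hb | hb | hb | hb | hb <;>
    grind only

/-- `W` is a path of the subgraph of `G` formed by `K`, induced in that subgraph. -/
def IsInducedPathIn (K : OddK4 G) {a b : V} (W : G.Walk a b) : Prop :=
  W.IsPath ∧ (∀ w ∈ W.support, w ∈ K.verts) ∧
    ∀ a ∈ W.support, ∀ b ∈ W.support, K.toSubgraph.Adj a b → s(a, b) ∈ W.edges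

lemma split_P2 {y : V} {T : G.Walk K.u3 y}
    {D : G.Walk y K.u4} (hPTD : K.P2 = T.append D) (hy3 : y ≠ K.u3) (hy4 : y ≠ K.u4)
    (hn : ¬ G.Adj K.u3 y) :
    (∀ w, w ∈ K.P2.support ↔ w ∈ T.support ∨ w ∈ D.support) ∧
    (∀ e, e ∈ K.P2.edges ↔ e ∈ T.edges ∨ e ∈ D.edges) ∧
    (∀ w, w ∈ T.support → w ∈ D.support → w = y) ∧ K.u3 ∉ D.support ∧ K.u4 ∉ T.support ∧
    T.IsPath ∧ D.IsPath ∧ ∀ {a b : V}, K.toSubgraph.Adj a b →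
      ¬ (a = K.u3 ∧ b = y) ∧ ¬ (b = K.u3 ∧ a = y) := by
  have hpath := K.hP2
  rw [hPTD] at hpath
  have hinter (w : V) (hT : w ∈ T.support) (hD : w ∈ D.support) : w = y := by
    have := hpath.support_nodup
    rw [support_append, List.nodup_append'] at this
    exact (D.mem_support_iff.mp hD).resolve_right (this.2.2 hT)
  refine ⟨fun w ↦ by rw [hPTD, mem_support_append_iff],
    fun e ↦ by rw [hPTD, edges_append, List.mem_append], hinter,
    fun h ↦ hy3 (hinter _ T.start_mem_support h).symm,
    fun h ↦ hy4 (hinter _ h D.end_mem_support).symm, hpath.of_append_left, hpath.of_append_right,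
    fun hab ↦ ⟨fun h ↦ hn (h.1 ▸ h.2 ▸ hab.adj_sub), fun h ↦ hn (h.1 ▸ h.2 ▸ hab.adj_sub.symm)⟩⟩

lemma isInducedPathIn_reverse {y : V} {T : G.Walk K.u3 y}
    {D : G.Walk y K.u4} (hPTD : K.P2 = T.append D) (hy3 : y ≠ K.u3) (hy4 : y ≠ K.u4)
    (hn : ¬ G.Adj K.u3 y) :
    K.IsInducedPathIn (T.reverse) := by
  obtain ⟨hsupp, hedges, hinter, hu3, hu4, hT, hD, hadj⟩ := K.split_P2 hPTD hy3 hy4 hn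
  refine ⟨hT.reverse, ?_, ?_⟩
  · simp only [mem_verts, hsupp, support_reverse, List.mem_reverse]
    grind only
  · intro a ha b hb hab
    simp only [edges_reverse, support_reverse, List.mem_reverse] at ha hb ⊢
    have := K.inter_support a
    have := K.inter_support b
    have := hadj hab
    have := hinter a
    have := hinter b
    have := hsupp a
    have := hsupp b
    rw [adj_toSubgraph, hedges] at hab
    rcases hab with h | (h | h) | h | h | h | h <;> have := ends_of_mem_edges h <;> grind only

lemma isInducedPathIn_append_Q2_L1 {y : V} {T : G.Walk K.u3 y}
    {D : G.Walk y K.u4} (hPTD : K.P2 = T.append D) (hy3 : y ≠ K.u3) (hy4 : y ≠ K.u4)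
    (hn : ¬ G.Adj K.u3 y) :
    K.IsInducedPathIn (D.append (K.Q2.reverse.append K.L1)) := by
  obtain ⟨hsupp, hedges, hinter, hu3, hu4, hT, hD, hadj⟩ := K.split_P2 hPTD hy3 hy4 hn
  refine ⟨by
      have hI := K.inter_support
      simp only [hsupp] at hI
      refine hD.append_of_inter (K.hQ2.reverse.append_of_inter K.hL1 ?_) ?_ <;>
        grind only [mem_support_append_iff, support_reverse, List.mem_reverse], ?_, ?_⟩
  · simp only [mem_verts, hsupp, mem_support_append_iff, support_reverse, List.mem_reverse]
    grind only
  · intro a ha b hb hab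
    simp only [edges_append, edges_reverse, mem_support_append_iff, support_reverse,
      List.mem_reverse, List.mem_append] at ha hb ⊢
    have := K.inter_support a
    have := K.inter_support b
    have := hadj hab
    have := hinter a
    have := hinter b
    have := hsupp a
    have := hsupp b
    rw [adj_toSubgraph, hedges] at hab
    rcases hab with h | (h | h) | h | h | h | h <;> have := ends_of_mem_edges h <;> grind only

lemma isInducedPathIn_append_Q2_P1_Q1 {y : V} {T : G.Walk K.u3 y}
    {D : G.Walk y K.u4} (hPTD : K.P2 = T.append D) (hy3 : y ≠ K.u3) (hy4 : y ≠ K.u4)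
    (hn : ¬ G.Adj K.u3 y) (hL : K.L1.length ≠ 1) (hL' : K.L2.length ≠ 1) :
    K.IsInducedPathIn (D.append (K.Q2.reverse.append (K.P1.append K.Q1))) := by
  obtain ⟨hsupp, hedges, hinter, hu3, hu4, hT, hD, hadj⟩ := K.split_P2 hPTD hy3 hy4 hn
  have hL := not_mem_edges_of_length_ne_one K.hL1 hL
  have hL' := not_mem_edges_of_length_ne_one K.hL2 hL'
  refine ⟨by
      have hI := K.inter_support
      simp only [hsupp] at hI
      refine hD.append_of_inter
        (K.hQ2.reverse.append_of_inter (K.hP1.append_of_inter K.hQ1 ?_) ?_) ?_ <;>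
        grind only [mem_support_append_iff, support_reverse, List.mem_reverse], ?_, ?_⟩
  · simp only [mem_verts, hsupp, mem_support_append_iff, support_reverse, List.mem_reverse]
    grind only
  · intro a ha b hb hab
    simp only [edges_append, edges_reverse, mem_support_append_iff, support_reverse,
      List.mem_reverse, List.mem_append] at ha hb ⊢
    have := K.inter_support a
    have := K.inter_support b
    have := hadj hab
    have := hinter a
    have := hinter b
    have := hsupp a
    have := hsupp b
    rw [adj_toSubgraph, hedges] at hab
    rcases hab with h | (h | h) | h | h | h | h <;> have := ends_of_mem_edges h <;> grind only

lemma isInducedPathIn_append_L2_P1_L1 {y : V} {T : G.Walk K.u3 y}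
    {D : G.Walk y K.u4} (hPTD : K.P2 = T.append D) (hy3 : y ≠ K.u3) (hy4 : y ≠ K.u4)
    (hn : ¬ G.Adj K.u3 y) (hQ : K.Q1.length ≠ 1) (hQ' : K.Q2.length ≠ 1) :
    K.IsInducedPathIn (D.append (K.L2.reverse.append (K.P1.reverse.append K.L1))) := by
  obtain ⟨hsupp, hedges, hinter, hu3, hu4, hT, hD, hadj⟩ := K.split_P2 hPTD hy3 hy4 hn
  have hQ := not_mem_edges_of_length_ne_one K.hQ1 hQ
  have hQ' := not_mem_edges_of_length_ne_one K.hQ2 hQ'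
  refine ⟨by
      have hI := K.inter_support
      simp only [hsupp] at hI
      refine hD.append_of_inter
        (K.hL2.reverse.append_of_inter (K.hP1.reverse.append_of_inter K.hL1 ?_) ?_) ?_ <;>
        grind only [mem_support_append_iff, support_reverse, List.mem_reverse], ?_, ?_⟩
  · simp only [mem_verts, hsupp, mem_support_append_iff, support_reverse, List.mem_reverse]
    grind only
  · intro a ha b hb hab
    simp only [edges_append, edges_reverse, mem_support_append_iff, support_reverse,
      List.mem_reverse, List.mem_append] at ha hb ⊢
    have := K.inter_support a
    have := K.inter_support b
    have := hadj hab
    have := hinter a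
    have := hinter b
    have := hsupp a
    have := hsupp b
    rw [adj_toSubgraph, hedges] at hab
    rcases hab with h | (h | h) | h | h | h | h <;> have := ends_of_mem_edges h <;> grind only

lemma isHole_append_of_detour (hind : K.toSubgraph.IsInduced) {u y : V} (hu : u ∈ K.verts)
    (hy : y ∈ K.verts) (hne : u ≠ y) (huy : ¬ G.Adj u y) {R : G.Walk u y} (hR : IsInducedPath G R)
    (hRK : ∀ w ∈ R.support, w ∈ K.verts → w = u ∨ w = y)
    (hRadj : ∀ w ∈ R.support, w ∉ K.verts → ∀ z ∈ K.verts, G.Adj w z → s(w, z) ∈ R.edges)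
    {W : G.Walk y u} (hW : K.IsInducedPathIn W) : IsHole G (R.append W) := by
  obtain ⟨hW, hWK, hWadj⟩ := hW
  have hW' : IsInducedPath G W := ⟨hW, fun a ha b hb hab ↦
    hWadj a ha b hb (hind (hWK a ha) (hWK b hb) hab)⟩
  refine isHole_append hR hW' hne huy (fun w hw hw' ↦ hRK w hw (hWK w hw')) ?_
  intro w hw z hz hwz
  by_cases hwK : w ∈ K.verts
  · have := W.start_mem_support
    have := W.end_mem_support
    rcases hRK w hw hwK with rfl | rfl <;> exact .inr (hW'.2 _ ‹_› z hz hwz)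
  · exact .inl (hRadj w hw hwK z (hWK z hz) hwz)

/-- If a path through the complement of the `K₄`-subdivision joins `u3` to an interior vertex `y`
of `P2`, then `u3` and `y` are adjacent. -/
lemma adj_of_detour (hG : InGFamily ℓ G) (hℓ : 2 ≤ ℓ) (hlong : K.longestPair) {y : V}
    (hy : y ∈ interiorL K.P2) {R : G.Walk K.u3 y} (hR : ¬ G.Adj K.u3 y → IsInducedPath G R)
    (hRK : ∀ w ∈ R.support, w ∈ K.verts → w = K.u3 ∨ w = y)
    (hRadj : ∀ w ∈ R.support, w ∉ K.verts → ∀ z ∈ K.verts, G.Adj w z → s(w, z) ∈ R.edges) :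
    G.Adj K.u3 y := by
  by_contra hn
  have hyn : y ∉ [K.u1, K.u2, K.u3, K.u4] := K.hbranch y (by simp [hy])
  have hy3 : y ≠ K.u3 := by grind
  have hy4 : y ≠ K.u4 := by grind
  have hyP := mem_support_of_mem_interiorL hy
  have hole {W : G.Walk y K.u3} := isHole_append_of_detour (W := W) (K.isInduced hG hℓ hlong)
    (K.mem_verts.2 (by simp)) (K.mem_verts.2 (by simp [hyP])) hy3.symm hn (hR hn) hRK hRadj
  have hodd {W : G.Walk y K.u3} (hW : K.IsInducedPathIn W) :
      Odd (R.append W).length → (R.append W).length = 2 * ℓ + 1 :=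
    fun ho ↦ hG.2 _ _ ⟨hole hW, ho⟩
  obtain ⟨hP, hQ, hL, hsum⟩ := K.length_eq hG
  have hPℓ := K.length_P1_le hG
  obtain ⟨T, D, hPTD⟩ := mem_support_iff_exists_append.mp hyP
  have hPD : K.P2.length = T.length + D.length := by rw [hPTD, length_append]
  have hDpos : D.length ≠ 0 := fun h ↦ hy4 (eq_of_length_eq_zero h)
  have hgirth := hG.1.ge.trans
    (egirth_le_length (hole (K.isInducedPathIn_reverse hPTD hy3 hy4 hn)).1)
  have hgirth : 2 * ℓ + 1 ≤ (R.append T.reverse).length := mod_cast hgirth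
  have hface := hodd (K.isInducedPathIn_append_Q2_L1 hPTD hy3 hy4 hn)
  have hlongQ (h : K.L1.length ≠ 1) :=
    hodd (K.isInducedPathIn_append_Q2_P1_Q1 hPTD hy3 hy4 hn h (hL ▸ h))
  have hlongL (h : K.Q1.length ≠ 1) :=
    hodd (K.isInducedPathIn_append_L2_P1_L1 hPTD hy3 hy4 hn h (hQ ▸ h))
  simp only [length_append, length_reverse, Nat.odd_iff] at hgirth hface hlongQ hlongL
  omega

/-- Edges of `G` between vertices of `P2` are edges of `P2`. -/
lemma mem_edges_P2 (hG : InGFamily ℓ G) (hℓ : 2 ≤ ℓ) (hlong : K.longestPair) {a b : V}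
    (hab : G.Adj a b) (ha : a ∈ K.P2.support) (hb : b ∈ K.P2.support) : s(a, b) ∈ K.P2.edges := by
  have h := K.isInduced hG hℓ hlong (K.mem_verts.2 (by simp [ha]))
    (K.mem_verts.2 (by simp [hb])) hab
  rw [adj_toSubgraph] at h
  have := hab.ne
  have := K.inter_support a
  have := K.inter_support b
  rcases h with h | h | h | h | h | h <;> have := ends_of_mem_edges h <;> grind only

end OddK4

/-- Claim 3.3: in the setup of the proof of Theorem 1.2, if
`x ∈ {u3, u4}` then `x` and `y` are adjacent, i.e. the edge `xy` is `e` or `f`. -/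
theorem claim_adjacent_ends {V : Type*}
    (ℓ : ℕ) (hℓ : 5 ≤ ℓ) (G : SimpleGraph V)
    (hG : InGFamily ℓ G) (hcrit : VertexCritical 4 G)
    (K : OddK4 G) (hlong : K.longestPair)
    (hmin : ∀ K' : OddK4 G, K'.longestPair → K.diff ≤ K'.diff)
    (e f : Sym2 V)
    (he : e = s(K.u3, K.P2.getVert 1))
    (hf : f = s(K.u4, K.P2.getVert (K.P2.length - 1)))
    (v1 v2 : V) (P : (G.deleteEdges {e, f}).Walk v1 v2)
    (hPind : IsInducedPath (G.deleteEdges {e, f}) P)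
    (hPdisj : ∀ w ∈ P.support, w ∉ K.verts)
    (hv2nbr : ∃ z ∈ interiorL K.P2, (G.deleteEdges {e, f}).Adj v2 z)
    (hv2only : ∀ w ∈ P.support,
      (∃ z ∈ interiorL K.P2, (G.deleteEdges {e, f}).Adj w z) → w = v2)
    (hv1nbr : ∃ z : V, z ∈ K.verts ∧ z ∉ interiorL K.P2 ∧ (G.deleteEdges {e, f}).Adj v1 z)
    (hv1only : ∀ w ∈ P.support,
      (∃ z : V, z ∈ K.verts ∧ z ∉ interiorL K.P2 ∧ (G.deleteEdges {e, f}).Adj w z) → w = v1)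
    (x y : V)
    (hy : y ∈ interiorL K.P2) (hv2y : G.Adj v2 y)
    (hyuniq : ∀ z ∈ interiorL K.P2, G.Adj v2 z → z = y)
    (hxH : x ∈ K.verts) (hxP2 : x ∉ interiorL K.P2) (hv1x : G.Adj v1 x)
    (hxuniq : ∀ z : V, z ∈ K.verts → z ∉ interiorL K.P2 → G.Adj v1 z → z = x)
    : (x = K.u3 ∨ x = K.u4) → G.Adj x y ∧ (s(x, y) = e ∨ s(x, y) = f) := by
  have hle : G.deleteEdges {e, f} ≤ G := deleteEdges_le _
  have heK : ∀ w, w ∈ e ∨ w ∈ f → w ∈ K.verts := by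
    simp only [he, hf, Sym2.mem_iff, OddK4.mem_verts]
    have h1 := K.P2.getVert_mem_support 1
    have h2 := K.P2.getVert_mem_support (K.P2.length - 1)
    grind [start_mem_support, end_mem_support]
  have hdel {a b : V} (ha : a ∉ K.verts) (hab : G.Adj a b) : (G.deleteEdges {e, f}).Adj a b := by
    refine deleteEdges_adj.2 ⟨hab, fun h ↦ ha (heK a ?_)⟩
    rcases h with h | h
    exacts [.inl (h ▸ Sym2.mem_mk_left a b),
      .inr (Set.mem_singleton_iff.mp h ▸ Sym2.mem_mk_left a b)]
  have hyP := mem_support_of_mem_interiorL hy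
  have hyK : y ∈ K.verts := K.mem_verts.2 (by simp [hyP])
  have hv1 := hPdisj v1 P.start_mem_support
  have hv2 := hPdisj v2 P.end_mem_support
  let R : G.Walk x y := .cons hv1x.symm ((P.mapLe hle).concat hv2y)
  have hRsupp (w : V) : w ∈ R.support ↔ w = x ∨ w ∈ P.support ∨ w = y := by
    simp [R, support_concat]
  have hRedges (d : Sym2 V) : d ∈ R.edges ↔ d = s(x, v1) ∨ d ∈ P.edges ∨ d = s(v2, y) := by
    simp [R, edges_concat]
  have hxy : x ≠ y := fun h ↦ hxP2 (h ▸ hy)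
  have hRpath : R.IsPath := by
    refine (cons_isPath_iff _ _).2 ⟨((isPath_mapLe hle).2 hPind.1).concat ?_ hv2y, ?_⟩
    · rw [support_mapLe_eq_support]
      exact fun h ↦ hPdisj y h hyK
    · simp only [support_concat, support_mapLe_eq_support, List.mem_append, List.mem_singleton]
      exact fun h ↦ h.elim (fun h ↦ hPdisj x h hxH) hxy
  have hRK (w : V) (hw : w ∈ R.support) (hwK : w ∈ K.verts) : w = x ∨ w = y := by
    rcases (hRsupp w).1 hw with h | h | h
    exacts [.inl h, absurd hwK (hPdisj w h), .inr h]
  have hRadj (w : V) (hw : w ∈ R.support) (hwK : w ∉ K.verts) (z : V) (hz : z ∈ K.verts)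
      (hwz : G.Adj w z) : s(w, z) ∈ R.edges := by
    have hwP : w ∈ P.support := by
      rcases (hRsupp w).1 hw with rfl | h | rfl
      exacts [absurd hxH hwK, h, absurd hyK hwK]
    rw [hRedges]
    by_cases hzP : z ∈ interiorL K.P2
    · obtain rfl := hv2only w hwP ⟨z, hzP, hdel hwK hwz⟩
      rw [hyuniq z hzP hwz]
      exact .inr (.inr rfl)
    · obtain rfl := hv1only w hwP ⟨z, hz, hzP, hdel hwK hwz⟩
      rw [hxuniq z hz hzP hwz]
      exact .inl Sym2.eq_swap
  have hRind (hn : ¬ G.Adj x y) : IsInducedPath G R := by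
    refine ⟨hRpath, fun a ha b hb hab ↦ ?_⟩
    by_cases haK : a ∈ K.verts
    · by_cases hbK : b ∈ K.verts
      · exfalso
        rcases hRK a ha haK with h | h <;> rcases hRK b hb hbK with h' | h'
        exacts [hab.ne (h.trans h'.symm), hn (h ▸ h' ▸ hab), hn (h ▸ h' ▸ hab.symm),
          hab.ne (h.trans h'.symm)]
      · rw [Sym2.eq_swap]
        exact hRadj b hb hbK a haK hab.symm
    · by_cases hbK : b ∈ K.verts
      · exact hRadj a ha haK b hbK hab
      · rw [hRsupp] at ha hb
        rw [hRedges]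
        refine .inr (.inl (hPind.2 a ?_ b ?_ (hdel haK hab))) <;> grind
  clear_value R
  rintro (rfl | rfl)
  · have h := K.adj_of_detour hG (by omega) hlong hy hRind hRK hRadj
    refine ⟨h, .inl ?_⟩
    have hmem := K.mem_edges_P2 hG (by omega) hlong h (by simp) hyP
    rw [he, K.hP2.eq_snd_of_mem_edges hmem]
  · have hyr : y ∈ interiorL K.swap.P2 := by simpa [OddK4.swap, interiorL_reverse] using hy
    have h : G.Adj K.u4 y := K.swap.adj_of_detour hG (by omega) hlong.swap hyr hRind
      (by rwa [K.verts_swap]) (by rwa [K.verts_swap])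
    refine ⟨h, .inr ?_⟩
    have hmem := K.mem_edges_P2 hG (by omega) hlong h (by simp) hyP
    rw [hf, K.hP2.eq_penultimate_of_mem_edges hmem]
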